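/- arXiv:1903.10133 — 2 statements merged into one kernel-verified Lean document; each statement's English description precedes it below -/
import Mathlib

section
/- Let G be a finite simple graph and let v be a vertex of degree exactly 5 lying on two pendent triangles v t1 t2 and v t3 t4 (so t1, t2, t3, t4 are distinct degree-2 vertices with t1~t2, t3~t4, and all four adjacent to v), and let v1 be the fifth neighbor of v. Suppose v1 has degree at most 3 in G. If the graph G − {v, t1, t2, t3, t4} has an FII-partition, then G has an FII-partition. -/
open scoped Classical

/-- `S` is a *2-independent set* of `G`: any two distinct vertices of `S` are at
distance at least 3 in `G`, i.e. they are non-adjacent and have no common neighbor. -/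
def TwoIndepSet {W : Type*} (G : SimpleGraph W) (S : Set W) : Prop :=
  ∀ u ∈ S, ∀ v ∈ S, u ≠ v → ¬G.Adj u v ∧ ∀ w, ¬(G.Adj u w ∧ G.Adj w v)

/-- `F ⊔ A ⊔ B` is an *FII-partition* of `G`: the three sets partition the vertex set,
the subgraph induced on `F` is a forest (acyclic), and `A`, `B` are 2-independent sets. -/
def IsFIIPartition {W : Type*} (G : SimpleGraph W) (F A B : Set W) : Prop :=
  (∀ v, v ∈ F ∨ v ∈ A ∨ v ∈ B) ∧
    Disjoint F A ∧ Disjoint F B ∧ Disjoint A B ∧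
    (G.induce F).IsAcyclic ∧ TwoIndepSet G A ∧ TwoIndepSet G B

/-- `G` admits some FII-partition. -/
def HasFIIPartition {W : Type*} (G : SimpleGraph W) : Prop :=
  ∃ F A B, IsFIIPartition G F A B

namespace SimpleGraph

variable {V : Type*} {G : SimpleGraph V}

theorem isAcyclic_induce_iff {F : Set V} :
    (G.induce F).IsAcyclic ↔
      ∀ ⦃u⦄ (c : G.Walk u u), c.IsCycle → ¬ ∀ x ∈ c.support, x ∈ F := by
  refine ⟨fun h u c hc hF ↦ ?_, fun h u c hc ↦ ?_⟩
  · refine h (c.induce F hF) (Walk.IsCycle.of_map (f := (Embedding.induce F).toHom) ?_)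
    rwa [Walk.map_induce]
  · refine h (c.map (Embedding.induce F).toHom) (hc.map (Embedding.induce (G := G) F).injective) ?_
    intro x hx
    rw [Walk.support_map, List.mem_map] at hx
    obtain ⟨y, -, rfl⟩ := hx
    exact y.2

/-- Adding a vertex with at most one neighbor in an induced forest preserves acyclicity. -/
theorem IsAcyclic.induce_insert {F : Set V} (h : (G.induce F).IsAcyclic) {x : V}
    (hx : ∀ y ∈ F, ∀ z ∈ F, G.Adj x y → G.Adj x z → y = z) :
    (G.induce (insert x F)).IsAcyclic := by
  rw [isAcyclic_induce_iff] at h ⊢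
  intro u c hc hF
  by_cases hxc : x ∈ c.support
  · have hr := hc.rotate hxc
    have hF' : ∀ y ∈ (c.rotate x hxc).support, y ∈ insert x F := fun y hy ↦
      hF y ((Walk.mem_support_rotate_iff ..).1 hy)
    have h1 := Walk.adj_snd hr.not_nil
    have h2 := (Walk.adj_penultimate hr.not_nil).symm
    exact hr.snd_ne_penultimate <| hx _
      ((hF' _ (Walk.getVert_mem_support _ _)).resolve_left h1.ne') _
      ((hF' _ (Walk.getVert_mem_support _ _)).resolve_left h2.ne') h1 h2
  · exact h c hc fun y hy ↦ (hF y hy).resolve_left (by rintro rfl; exact hxc hy)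

theorem mem_of_adj_of_degree_le_card [Fintype V] {v w : V} {s : Finset V}
    (hs : ∀ x ∈ s, G.Adj v x) (hd : G.degree v ≤ s.card) (hw : G.Adj v w) : w ∈ s := by
  have : s = G.neighborFinset v :=
    Finset.eq_of_subset_of_card_le (fun x hx ↦ by simpa using hs x hx) (by simpa using hd)
  simpa [this] using hw

end SimpleGraph

open SimpleGraph

section

variable {V : Type*} {G : SimpleGraph V}

theorem TwoIndepSet.mono {A B : Set V} (h : TwoIndepSet G B) (hAB : A ⊆ B) :
    TwoIndepSet G A :=
  fun u hu v hv ↦ h u (hAB hu) v (hAB hv)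

theorem TwoIndepSet.insert {A : Set V} (h : TwoIndepSet G A) {x : V}
    (hx : ∀ a ∈ A, ¬ G.Adj x a ∧ ∀ w, ¬ (G.Adj x w ∧ G.Adj w a)) :
    TwoIndepSet G (insert x A) := by
  rintro u (rfl | hu) w (rfl | hw) hne
  · exact absurd rfl hne
  · exact hx w hw
  · exact ⟨fun e ↦ (hx u hu).1 e.symm, fun z hz ↦ (hx u hu).2 z ⟨hz.2.symm, hz.1.symm⟩⟩
  · exact h u hu w hw hne

/-- A 2-independent set of an induced subgraph is 2-independent in the whole graph as soon as no
vertex outside the subgraph has two neighbors in it. -/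
theorem TwoIndepSet.image_val {s : Set V} {A : Set s} (h : TwoIndepSet (G.induce s) A)
    (hs : ∀ w ∉ s, ∀ x ∈ s, ∀ y ∈ s, G.Adj w x → G.Adj w y → x = y) :
    TwoIndepSet G (Subtype.val '' A) := by
  rintro _ ⟨u, hu, rfl⟩ _ ⟨w, hw, rfl⟩ hne
  have h' := h u hu w hw fun e ↦ hne (congrArg _ e)
  refine ⟨h'.1, fun z ⟨hz, hz'⟩ ↦ ?_⟩
  by_cases hzs : z ∈ s
  · exact h'.2 ⟨z, hzs⟩ ⟨hz, hz'⟩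
  · exact hne (hs z hzs _ u.2 _ w.2 hz.symm hz')

theorem SimpleGraph.IsAcyclic.image_val {s : Set V} {F : Set s}
    (h : ((G.induce s).induce F).IsAcyclic) : (G.induce (Subtype.val '' F)).IsAcyclic := by
  have hF : ∀ x : (Subtype.val '' F : Set V), ∃ hx : x.1 ∈ s, ⟨x.1, hx⟩ ∈ F := by
    rintro ⟨_, x, hx, rfl⟩
    exact ⟨x.2, hx⟩
  refine h.comap (f := ⟨fun x ↦ ⟨⟨x, (hF x).1⟩, (hF x).2⟩, fun hxy ↦ hxy⟩) fun x y hxy ↦ ?_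
  exact Subtype.ext (congrArg (fun z ↦ z.1.1) hxy)

/-- An FII-partition of the subgraph induced on `s`, given by subsets of the whole vertex set whose
two independent parts are 2-independent in the whole graph. -/
structure IsFIIPartitionOn (G : SimpleGraph V) (s F A B : Set V) : Prop where
  union_eq : F ∪ A ∪ B = s
  disjoint_FA : Disjoint F A
  disjoint_FB : Disjoint F B
  disjoint_AB : Disjoint A B
  isAcyclic : (G.induce F).IsAcyclic
  twoIndepSet_A : TwoIndepSet G A
  twoIndepSet_B : TwoIndepSet G B

namespace IsFIIPartitionOn

variable {s F A B : Set V}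

theorem symm (h : IsFIIPartitionOn G s F A B) : IsFIIPartitionOn G s F B A where
  union_eq := by rw [Set.union_right_comm, h.union_eq]
  disjoint_FA := h.disjoint_FB
  disjoint_FB := h.disjoint_FA
  disjoint_AB := h.disjoint_AB.symm
  isAcyclic := h.isAcyclic
  twoIndepSet_A := h.twoIndepSet_B
  twoIndepSet_B := h.twoIndepSet_A

theorem hasFIIPartition (h : IsFIIPartitionOn G Set.univ F A B) : HasFIIPartition G :=
  ⟨F, A, B, fun v ↦ by simpa [or_assoc] using h.union_eq.ge (Set.mem_univ v), h.disjoint_FA,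
    h.disjoint_FB, h.disjoint_AB, h.isAcyclic, h.twoIndepSet_A, h.twoIndepSet_B⟩

theorem insert_F (h : IsFIIPartitionOn G s F A B) {x : V} (hxs : x ∉ s)
    (hx : ∀ y ∈ F, ∀ z ∈ F, G.Adj x y → G.Adj x z → y = z) :
    IsFIIPartitionOn G (insert x s) (insert x F) A B := by
  obtain ⟨rfl, h1, h2, h3, h4, h5, h6⟩ := h
  simp only [Set.mem_union, not_or] at hxs
  exact ⟨by simp [Set.insert_union], Set.disjoint_insert_left.2 ⟨hxs.1.2, h1⟩,
    Set.disjoint_insert_left.2 ⟨hxs.2, h2⟩, h3, h4.induce_insert hx, h5, h6⟩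

theorem insert_A (h : IsFIIPartitionOn G s F A B) {x : V} (hxs : x ∉ s)
    (hx : ∀ a ∈ A, ¬ G.Adj x a ∧ ∀ w, ¬ (G.Adj x w ∧ G.Adj w a)) :
    IsFIIPartitionOn G (insert x s) F (insert x A) B := by
  obtain ⟨rfl, h1, h2, h3, h4, h5, h6⟩ := h
  simp only [Set.mem_union, not_or] at hxs
  exact ⟨by simp [Set.insert_union, Set.union_insert],
    Set.disjoint_insert_right.2 ⟨hxs.1.1, h1⟩, h2, Set.disjoint_insert_left.2 ⟨hxs.2, h3⟩, h4,
    h5.insert hx, h6⟩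

theorem insert_B (h : IsFIIPartitionOn G s F A B) {x : V} (hxs : x ∉ s)
    (hx : ∀ a ∈ B, ¬ G.Adj x a ∧ ∀ w, ¬ (G.Adj x w ∧ G.Adj w a)) :
    IsFIIPartitionOn G (insert x s) F A (insert x B) :=
  (h.symm.insert_A hxs hx).symm

/-- Move a vertex with at most one neighbor in the forest into the forest. -/
theorem move_A_F (h : IsFIIPartitionOn G s F A B) {x : V} (hxA : x ∈ A)
    (hx : ∀ y ∈ F, ∀ z ∈ F, G.Adj x y → G.Adj x z → y = z) :
    IsFIIPartitionOn G s (insert x F) (A \ {x}) B := by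
  obtain ⟨rfl, h1, h2, h3, h4, h5, h6⟩ := h
  refine ⟨?_, ?_, Set.disjoint_insert_left.2 ⟨Set.disjoint_left.1 h3 hxA, h2⟩,
    h3.mono_left Set.sdiff_subset, h4.induce_insert hx, h5.mono Set.sdiff_subset, h6⟩
  · ext y
    simp only [Set.mem_union, Set.mem_insert_iff, Set.mem_sdiff, Set.mem_singleton_iff]
    grind
  · exact Set.disjoint_insert_left.2 ⟨by simp, h1.mono_right Set.sdiff_subset⟩

end IsFIIPartitionOn

theorem IsFIIPartition.image_val {s : Set V} {F A B : Set s}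
    (h : IsFIIPartition (G.induce s) F A B)
    (hs : ∀ w ∉ s, ∀ x ∈ s, ∀ y ∈ s, G.Adj w x → G.Adj w y → x = y) :
    IsFIIPartitionOn G s (Subtype.val '' F) (Subtype.val '' A) (Subtype.val '' B) := by
  obtain ⟨h0, h1, h2, h3, h4, h5, h6⟩ := h
  refine ⟨?_, (Set.disjoint_image_iff Subtype.val_injective).2 h1,
    (Set.disjoint_image_iff Subtype.val_injective).2 h2,
    (Set.disjoint_image_iff Subtype.val_injective).2 h3, h4.image_val, h5.image_val hs,
    h6.image_val hs⟩
  have : F ∪ A ∪ B = Set.univ := Set.eq_univ_of_forall fun x ↦ by simpa [or_assoc] using h0 x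
  rw [← Set.image_union, ← Set.image_union, this, Set.image_univ, Subtype.range_coe]

end

/-- [C9] (main case) If `v` is a 5-vertex on two pendent triangles `v t1 t2`, `v t3 t4`
whose fifth neighbor `v1` has degree at most 3, and `G − {v, t1, t2, t3, t4}` has an
FII-partition, then so does `G`. -/
theorem hasFIIPartition_of_W5_with_small_neighbor {V : Type*} [Fintype V]
    (G : SimpleGraph V) (v t1 t2 t3 t4 v1 : V)
    (hne : List.Pairwise (· ≠ ·) [v, t1, t2, t3, t4, v1])
    (ht1 : G.Adj v t1) (ht2 : G.Adj v t2) (ht3 : G.Adj v t3) (ht4 : G.Adj v t4)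
    (h12 : G.Adj t1 t2) (h34 : G.Adj t3 t4)
    (hv1 : G.Adj v v1)
    (hdv : G.degree v = 5)
    (hdt1 : G.degree t1 = 2) (hdt2 : G.degree t2 = 2)
    (hdt3 : G.degree t3 = 2) (hdt4 : G.degree t4 = 2)
    (hdv1 : G.degree v1 ≤ 3)
    (h : HasFIIPartition (G.induce ({v, t1, t2, t3, t4} : Set V)ᶜ)) :
    HasFIIPartition G := by
  simp only [List.pairwise_cons, List.mem_cons, List.not_mem_nil, or_false, forall_eq_or_imp,
    forall_eq, List.Pairwise.nil, and_true, false_imp_iff, implies_true] at hne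
  have hNv : ∀ w, G.Adj v w → w = t1 ∨ w = t2 ∨ w = t3 ∨ w = t4 ∨ w = v1 := fun w hw ↦ by
    have hcard : ({t1, t2, t3, t4, v1} : Finset V).card = 5 := by grind
    simpa using mem_of_adj_of_degree_le_card (s := {t1, t2, t3, t4, v1})
      (by simp [ht1, ht2, ht3, ht4, hv1]) (by omega) hw
  have hN : ∀ t t', G.Adj v t → G.Adj t t' → t' ≠ v → G.degree t = 2 →
      ∀ w, G.Adj t w → w = t' ∨ w = v := fun t t' htv htt' hne hd w hw ↦ by
    simpa using mem_of_adj_of_degree_le_card (s := {t', v})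
      (by simp [htv.symm, htt']) (by rw [Finset.card_pair hne, hd]) hw
  have hN1 := hN t1 t2 ht1 h12 (by grind) hdt1
  have hN2 := hN t2 t1 ht2 h12.symm (by grind) hdt2
  have hN3 := hN t3 t4 ht3 h34 (by grind) hdt3
  have hN4 := hN t4 t3 ht4 h34.symm (by grind) hdt4
  set s : Set V := {v, t1, t2, t3, t4}ᶜ with hs
  have hms : ∀ x, x ∈ s ↔ x ≠ v ∧ x ≠ t1 ∧ x ≠ t2 ∧ x ≠ t3 ∧ x ≠ t4 := fun x ↦ by simp [hs]
  have hv1s : v1 ∈ s := by grind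
  have huniv : insert t4 (insert t3 (insert t2 (insert t1 (insert v s)))) = Set.univ := by
    ext x
    have := hms x
    simp only [Set.mem_insert_iff, Set.mem_univ, iff_true]
    tauto
  -- If `v1` has no neighbor in `A`, put `v` in `A` and the triangles in the forest.
  have key_A : ∀ F A B, IsFIIPartitionOn G s F A B → v1 ∉ A → (∀ a ∈ A, ¬ G.Adj v1 a) →
      HasFIIPartition G := by
    intro F A B h hA hadj
    have hFs : ∀ x ∈ F, x ∈ s := fun x hx ↦ h.union_eq.le (.inl (.inl hx))
    have hAs : ∀ x ∈ A, x ∈ s := fun x hx ↦ h.union_eq.le (.inl (.inr hx))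
    refine IsFIIPartitionOn.hasFIIPartition (huniv ▸ ((((h.insert_A (x := v) ?_ ?_).insert_F
      (x := t1) ?_ ?_).insert_F (x := t2) ?_ ?_).insert_F (x := t3) ?_ ?_).insert_F
      (x := t4) ?_ ?_)
    all_goals try simp only [Set.mem_insert_iff]
    all_goals grind [SimpleGraph.Adj.symm]
  -- If `v1` is in the forest, put `t1` in `A`, `t3` in `B` and `v`, `t2`, `t4` in the forest.
  have key_F : ∀ F A B, IsFIIPartitionOn G s F A B → v1 ∈ F → HasFIIPartition G := by
    intro F A B h hF
    have hFs : ∀ x ∈ F, x ∈ s := fun x hx ↦ h.union_eq.le (.inl (.inl hx))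
    have hAs : ∀ x ∈ A, x ∈ s := fun x hx ↦ h.union_eq.le (.inl (.inr hx))
    have hBs : ∀ x ∈ B, x ∈ s := fun x hx ↦ h.union_eq.le (.inr hx)
    have hFA := Set.disjoint_left.1 h.disjoint_FA hF
    have hFB := Set.disjoint_left.1 h.disjoint_FB hF
    refine IsFIIPartitionOn.hasFIIPartition (huniv ▸ ((((h.insert_F (x := v) ?_ ?_).insert_A
      (x := t1) ?_ ?_).insert_F (x := t2) ?_ ?_).insert_B (x := t3) ?_ ?_).insert_F
      (x := t4) ?_ ?_)
    all_goals try simp only [Set.mem_insert_iff]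
    all_goals grind [SimpleGraph.Adj.symm]
  -- If `v1` is in `A` with a neighbor in `B`, then `v1` can be moved to the forest.
  have key_move : ∀ F A B, IsFIIPartitionOn G s F A B → v1 ∈ A → HasFIIPartition G := by
    intro F A B h hA
    by_cases hB : ∀ b ∈ B, ¬ G.Adj v1 b
    · exact key_A F B A h.symm (Set.disjoint_left.1 h.disjoint_AB hA) hB
    push Not at hB
    obtain ⟨b, hb, hv1b⟩ := hB
    refine key_F _ _ _ (h.move_A_F hA fun y hy z hz hay haz ↦ ?_) (Set.mem_insert _ _)
    by_contra hyz
    have hFB := Set.disjoint_left.1 h.disjoint_FB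
    have hys : y ∈ s := h.union_eq.le (.inl (.inl hy))
    have hbs : b ∈ s := h.union_eq.le (.inr hb)
    have hcard : ({b, y, z} : Finset V).card = 3 := by grind
    have := mem_of_adj_of_degree_le_card (G := G) (v := v1) (s := {b, y, z})
      (by simp [hv1b, hay, haz]) (by omega) hv1.symm
    have hzs : z ∈ s := h.union_eq.le (.inl (.inl hz))
    grind
  obtain ⟨F', A', B', h⟩ := h
  have h' := h.image_val (by
    intro w hw x hx y hy hwx hwy
    rw [hms] at hw hx hy
    grind)
  rcases h'.union_eq.ge hv1s with (hF | hA) | hB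
  · exact key_F _ _ _ h' hF
  · exact key_move _ _ _ h' hA
  · exact key_move _ _ _ h'.symm hB
end

section
/- Let G be a finite simple graph with no FII-partition, and suppose G contains a cycle C: u1 v1 u2 v2 … uk vk of length 2k (k ≥ 2) in which each u_i has degree exactly 2 in G and each v_i has degree exactly 3 in G with third neighbor z_i not on C. Let H = G − V(C) and let Z = {z1, …, zk}. Then for every FII-partition F ⊔ Iα ⊔ Iβ of H, either Z ⊆ F or Z ∩ F = ∅. -/
open scoped Classical

/-- If `c` is prescribed at the points outside `P` and `P` misses some point of `ZMod k`, then
`c` extends to all of `ZMod k` so that it alternates upon entering each point of `P`. -/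
theorem exists_alternating_extension {k : ℕ} [NeZero k] (P c : ZMod k → Prop) {j : ZMod k}
    (hj : ¬P j) :
    ∃ d : ZMod k → Prop, (∀ i, ¬P i → (d i ↔ c i)) ∧ ∀ i, P i → (d i ↔ ¬d (i - 1)) := by
  have hex : ∀ i : ZMod k, ∃ n : ℕ, ¬P (i - n) := fun i => ⟨(i - j).val, by simpa using hj⟩
  refine ⟨fun i => Even (Nat.find (hex i)) ↔ c (i - Nat.find (hex i)), fun i hi => ?_,
    fun i hi => ?_⟩
  · have h0 : Nat.find (hex i) = 0 := by simpa [Nat.find_eq_zero] using hi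
    simp [h0]
  · have h1 : Nat.find (hex i) = Nat.find (hex (i - 1)) + 1 := by
      rw [Nat.find_eq_iff]
      refine ⟨?_, fun n hn => ?_⟩
      · have := Nat.find_spec (hex (i - 1))
        rwa [Nat.cast_add, Nat.cast_one, add_comm, ← sub_sub]
      · cases n with
        | zero => simpa using hi
        | succ n =>
          have := Nat.find_min (hex (i - 1)) (Nat.lt_of_succ_lt_succ hn)
          rwa [Nat.cast_add, Nat.cast_one, add_comm, ← sub_sub]
    have h2 : i - (Nat.find (hex i) : ZMod k) = i - 1 - (Nat.find (hex (i - 1)) : ZMod k) := by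
      rw [h1, Nat.cast_add, Nat.cast_one, add_comm, ← sub_sub]
    simp only [h2]
    rw [h1, Nat.even_add_one]
    tauto

/-- An induced subgraph is acyclic if and only if no cycle of the ambient graph lives in it. -/
theorem isAcyclic_induce_iff {V : Type*} {G : SimpleGraph V} {S : Set V} :
    (G.induce S).IsAcyclic ↔
      ∀ (x : V) (p : G.Walk x x), p.IsCycle → ¬∀ y ∈ p.support, y ∈ S := by
  constructor
  · intro h x p hp hS
    refine h (p.induce S hS) ?_
    rw [← SimpleGraph.Walk.isCycle_map_iff_of_injective
      (f := (SimpleGraph.Embedding.induce S).toHom) Subtype.val_injective,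
      SimpleGraph.Walk.map_induce]
    exact hp
  · intro h x p hp
    refine h _ (p.map (SimpleGraph.Embedding.induce S).toHom)
      ((SimpleGraph.Walk.isCycle_map_iff_of_injective Subtype.val_injective).2 hp) ?_
    intro y hy
    rw [SimpleGraph.Walk.support_map, List.mem_map] at hy
    obtain ⟨w, -, rfl⟩ := hy
    exact w.2

/-- Every vertex of a cycle has a neighbor on the cycle other than a given vertex. -/
theorem SimpleGraph.Walk.IsCycle.exists_adj_mem_support_ne {V : Type*} {G : SimpleGraph V}
    {x : V} {p : G.Walk x x} (hp : p.IsCycle) {y : V} (hy : y ∈ p.support) (w : V) :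
    ∃ t ∈ p.support, G.Adj y t ∧ t ≠ w := by
  have h2 := hp.ncard_neighborSet_toSubgraph_eq_two hy
  obtain ⟨t, ht, htw⟩ := Set.exists_ne_of_one_lt_ncard (h2 ▸ one_lt_two) w
  exact ⟨t, (SimpleGraph.Walk.mem_verts_toSubgraph p).1 ht.snd_mem, ht.adj_sub, htw⟩

/-- A 2-independent set of `G - V(C)` extended by pairwise far apart vertices `u i` of `C` that
are also far from the set is 2-independent in `G`. -/
theorem TwoIndepSet.union_image {V : Type*} {G : SimpleGraph V} {k : ℕ} {u v z : ZMod k → V}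
    (huv : ∀ i j, u i ≠ v j) (hu : Function.Injective u)
    (hnu : ∀ i x, G.Adj (u i) x → x = v i ∨ x = v (i - 1))
    (hnv : ∀ i x, G.Adj (v i) x → x = u i ∨ x = u (i + 1) ∨ x = z i)
    (hz : ∀ i, z i ∉ Set.range u ∪ Set.range v)
    {S : Set ((Set.range u ∪ Set.range v)ᶜ : Set V)}
    (hS : TwoIndepSet (G.induce (Set.range u ∪ Set.range v)ᶜ) S) {e : ZMod k → Prop}
    (he : ∀ i, e i → z i ∉ Subtype.val '' S ∧ z (i - 1) ∉ Subtype.val '' S ∧ ¬e (i - 1)) :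
    TwoIndepSet G (Subtype.val '' S ∪ u '' {i | e i}) := by
  have hSC : ∀ x ∈ Subtype.val '' S, (∀ i, x ≠ u i) ∧ ∀ i, x ≠ v i := by
    rintro _ ⟨⟨x, hx⟩, -, rfl⟩
    simp only [Set.mem_compl_iff, Set.mem_union, Set.mem_range, not_or, not_exists] at hx
    exact ⟨fun i h => hx.1 i h.symm, fun i h => hx.2 i h.symm⟩
  have hzu : ∀ i j, u i ≠ z j := fun i j h => hz j (Or.inl ⟨i, h⟩)
  have hmix : ∀ i, e i → ∀ x ∈ Subtype.val '' S,
      ¬G.Adj (u i) x ∧ ∀ w, ¬(G.Adj (u i) w ∧ G.Adj w x) := by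
    intro i hi x hx
    obtain ⟨h1, h2⟩ := hSC x hx
    obtain ⟨h3, h4, -⟩ := he i hi
    refine ⟨fun h => by grind, fun w hw => ?_⟩
    rcases hnu i w hw.1 with rfl | rfl
    · have := hnv _ _ hw.2
      grind
    · have := hnv _ _ hw.2
      grind
  rintro x (hx | ⟨i, hi, rfl⟩) y (hy | ⟨j, hj, rfl⟩) hxy
  · obtain ⟨hxu, hxv⟩ := hSC x hx
    obtain ⟨hyu, hyv⟩ := hSC y hy
    obtain ⟨x, hxS, rfl⟩ := hx
    obtain ⟨y, hyS, rfl⟩ := hy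
    obtain ⟨h1, h2⟩ := hS x hxS y hyS (fun h => hxy (congrArg _ h))
    refine ⟨h1, fun w hw => ?_⟩
    by_cases hwC : w ∈ Set.range u ∪ Set.range v
    · rcases hwC with ⟨i, rfl⟩ | ⟨i, rfl⟩
      · have := hnu _ _ hw.2
        grind
      · have h3 := hnv _ _ hw.2
        have h4 := hnv _ _ hw.1.symm
        grind
    · exact h2 ⟨w, hwC⟩ hw
  · obtain ⟨h1, h2⟩ := hmix j hj x hx
    exact ⟨fun h => h1 h.symm, fun w hw => h2 w ⟨hw.2.symm, hw.1.symm⟩⟩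
  · exact hmix i hi y hy
  · have hij : i ≠ j := fun h => hxy (congrArg u h)
    have hi' := (he i hi).2.2
    have hj' := (he j hj).2.2
    refine ⟨fun h => by grind, fun w hw => ?_⟩
    rcases hnu i w hw.1 with rfl | rfl
    · rcases hnv _ _ hw.2 with h | h | h
      · exact hxy h.symm
      · rw [hu h, add_sub_cancel_right] at hj'
        exact hj' hi
      · exact hzu _ _ h
    · rcases hnv _ _ hw.2 with h | h | h
      · exact hi' (hu h ▸ hj)
      · exact hxy (by rw [h, sub_add_cancel])
      · exact hzu _ _ h

/-- Adding to a forest `F` of `G - V(C)` all `v i`, and those `u i` for which `z i ∉ F`, yields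
a forest of `G`, provided some `z j` is in `F`. -/
theorem isAcyclic_induce_union_cycle {V : Type*} {G : SimpleGraph V} {k : ℕ} [NeZero k]
    {u v z : ZMod k → V}
    (huv : ∀ i j, u i ≠ v j) (hu : Function.Injective u)
    (hnu : ∀ i x, G.Adj (u i) x → x = v i ∨ x = v (i - 1))
    (hnv : ∀ i x, G.Adj (v i) x → x = u i ∨ x = u (i + 1) ∨ x = z i)
    (hz : ∀ i, z i ∉ Set.range u ∪ Set.range v)
    {F : Set ((Set.range u ∪ Set.range v)ᶜ : Set V)}
    (hF : ((G.induce (Set.range u ∪ Set.range v)ᶜ).induce F).IsAcyclic)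
    {j : ZMod k} (hj : z j ∈ Subtype.val '' F) :
    (G.induce (Subtype.val '' F ∪ Set.range v ∪ u '' {i | z i ∉ Subtype.val '' F})).IsAcyclic := by
  rw [isAcyclic_induce_iff]
  intro x p hp hsub
  have huF : ∀ i, u i ∉ Subtype.val '' F := by
    rintro i ⟨⟨y, hy⟩, -, rfl⟩
    exact hy (Or.inl ⟨i, rfl⟩)
  have hu_mem : ∀ i, u i ∈ p.support → z i ∉ Subtype.val '' F := by
    intro i hi
    rcases hsub _ hi with (h | ⟨l, h⟩) | ⟨l, hl, h⟩
    · exact absurd h (huF i)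
    · exact absurd h.symm (huv i l)
    · exact hu h ▸ hl
  have hz_mem : ∀ i, z i ∈ p.support → z i ∈ Subtype.val '' F := by
    intro i hi
    rcases hsub _ hi with (h | h) | ⟨l, hl, h⟩
    · exact h
    · exact absurd (Or.inr h) (hz i)
    · exact absurd (Or.inl ⟨l, h⟩) (hz i)
  have hstep : ∀ i, v i ∈ p.support → u (i + 1) ∈ p.support := by
    intro i hi
    by_cases hzi : z i ∈ Subtype.val '' F
    · obtain ⟨t, ht, hadj, hne⟩ := hp.exists_adj_mem_support_ne hi (z i)
      rcases hnv i t hadj with rfl | rfl | rfl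
      · exact absurd hzi (hu_mem _ ht)
      · exact ht
      · exact absurd rfl hne
    · obtain ⟨t, ht, hadj, hne⟩ := hp.exists_adj_mem_support_ne hi (u i)
      rcases hnv i t hadj with rfl | rfl | rfl
      · exact absurd rfl hne
      · exact ht
      · exact absurd (hz_mem _ ht) hzi
  have hu_not : ∀ i, u i ∉ p.support := by
    intro i hi
    have hall : ∀ n : ℕ, u (i + n) ∈ p.support := by
      intro n
      induction n with
      | zero => simpa using hi
      | succ n ih =>
        obtain ⟨t, ht, hadj, hne⟩ := hp.exists_adj_mem_support_ne ih (v (i + n - 1))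
        rcases hnu _ t hadj with rfl | rfl
        · simpa [add_assoc] using hstep _ ht
        · exact absurd rfl hne
    have := hall (j - i).val
    rw [ZMod.natCast_zmod_val, add_sub_cancel] at this
    exact hu_mem j this hj
  have hpF : ∀ y ∈ p.support, y ∈ Subtype.val '' F := by
    intro y hy
    rcases hsub y hy with (h | ⟨i, rfl⟩) | ⟨i, -, rfl⟩
    · exact h
    · exact absurd (hstep i hy) (hu_not _)
    · exact absurd hy (hu_not i)
  have hpC : ∀ y ∈ p.support, y ∈ (Set.range u ∪ Set.range v)ᶜ := by
    intro y hy
    obtain ⟨w, -, rfl⟩ := hpF y hy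
    exact w.2
  rw [isAcyclic_induce_iff] at hF
  refine hF _ (p.induce _ hpC) ?_ ?_
  · rw [← SimpleGraph.Walk.isCycle_map_iff_of_injective
      (f := (SimpleGraph.Embedding.induce (Set.range u ∪ Set.range v)ᶜ).toHom)
      Subtype.val_injective, SimpleGraph.Walk.map_induce]
    exact hp
  · intro y hy
    have hy' : (y : V) ∈ p.support := by
      simpa [SimpleGraph.Walk.support_induce] using hy
    obtain ⟨w, hw, hwy⟩ := hpF _ hy'
    exact Subtype.ext hwy ▸ hw

/-- Claim 4.2: Let `G` be a finite graph with no FII-partition containing a cycle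
`u₁ v₁ u₂ v₂ … u_k v_k` (`k ≥ 2`) where every `u_i` is a 2-vertex and every `v_i` is a
3-vertex with third neighbor `z_i` off the cycle.  Then in every FII-partition
`F ⊔ A ⊔ B` of `H = G − V(C)`, either all `z_i` are in `F` or none is. -/
theorem claim_Z_subset_F_or_disjoint {V : Type*} [Fintype V]
    (G : SimpleGraph V) (hG : ¬HasFIIPartition G)
    (k : ℕ) (hk : 2 ≤ k) (u v z : ZMod k → V)
    (hu : Function.Injective u) (hv : Function.Injective v)
    (huv : ∀ i j, u i ≠ v j)
    (hadj1 : ∀ i, G.Adj (u i) (v i))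
    (hadj2 : ∀ i, G.Adj (v i) (u (i + 1)))
    (hdu : ∀ i, G.degree (u i) = 2)
    (hdv : ∀ i, G.degree (v i) = 3)
    (hvz : ∀ i, G.Adj (v i) (z i))
    (hz : ∀ i, z i ∉ Set.range u ∪ Set.range v)
    (F A B : Set ((Set.range u ∪ Set.range v)ᶜ : Set V))
    (hFII : IsFIIPartition (G.induce (Set.range u ∪ Set.range v)ᶜ) F A B) :
    (∀ i, (⟨z i, hz i⟩ : ((Set.range u ∪ Set.range v)ᶜ : Set V)) ∈ F) ∨
      ∀ i, (⟨z i, hz i⟩ : ((Set.range u ∪ Set.range v)ᶜ : Set V)) ∉ F := by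
  have : NeZero k := ⟨by omega⟩
  have : Fact (1 < k) := ⟨hk⟩
  have hnu : ∀ i x, G.Adj (u i) x → x = v i ∨ x = v (i - 1) := by
    intro i x hx
    have hsub : {v i, v (i - 1)} ⊆ G.neighborFinset (u i) := by
      intro y hy
      simp only [Finset.mem_insert, Finset.mem_singleton] at hy
      rw [SimpleGraph.mem_neighborFinset]
      rcases hy with rfl | rfl
      · exact hadj1 i
      · simpa using (hadj2 (i - 1)).symm
    have hne : v i ≠ v (i - 1) := fun h => one_ne_zero (sub_eq_self.1 (hv h).symm)
    have heq := Finset.eq_of_subset_of_card_le hsub (by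
      rw [SimpleGraph.card_neighborFinset_eq_degree, hdu, Finset.card_pair hne])
    have hx' : x ∈ G.neighborFinset (u i) := (G.mem_neighborFinset _ _).2 hx
    simpa [← heq] using hx'
  have hnv : ∀ i x, G.Adj (v i) x → x = u i ∨ x = u (i + 1) ∨ x = z i := by
    intro i x hx
    have hsub : {u i, u (i + 1), z i} ⊆ G.neighborFinset (v i) := by
      intro y hy
      simp only [Finset.mem_insert, Finset.mem_singleton] at hy
      rw [SimpleGraph.mem_neighborFinset]
      rcases hy with rfl | rfl | rfl
      · exact (hadj1 i).symm
      · exact hadj2 i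
      · exact hvz i
    have hne : u i ≠ u (i + 1) := fun h => one_ne_zero (left_eq_add.1 (hu h))
    have hzu : ∀ l, u l ≠ z i := fun l h => hz i (Or.inl ⟨l, h⟩)
    have heq := Finset.eq_of_subset_of_card_le hsub (by
      rw [SimpleGraph.card_neighborFinset_eq_degree, hdv,
        Finset.card_eq_three.2 ⟨_, _, _, hne, hzu i, hzu _, rfl⟩])
    have hx' : x ∈ G.neighborFinset (v i) := (G.mem_neighborFinset _ _).2 hx
    simpa [← heq] using hx'
  by_contra! hcon
  obtain ⟨⟨j, hj⟩, l, hl⟩ := hcon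
  obtain ⟨hcov, hFA, hFB, hAB, hac, hA, hB⟩ := hFII
  have hval : ∀ (S : Set ((Set.range u ∪ Set.range v)ᶜ : Set V)) i,
      z i ∈ Subtype.val '' S ↔ ⟨z i, hz i⟩ ∈ S := fun S i =>
    ⟨fun ⟨_, hy, h⟩ => (Subtype.ext h : _ = (⟨z i, hz i⟩ : ((_ : Set V)ᶜ : Set V))) ▸ hy,
      fun h => ⟨_, h, rfl⟩⟩
  obtain ⟨d, hd1, hd2⟩ := exists_alternating_extension
    (fun i => z i ∈ Subtype.val '' F) (fun i => z i ∈ Subtype.val '' A) (j := j)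
    (by rwa [hval])
  simp only [hval] at hd1 hd2
  have hFA' : ∀ i, ⟨z i, hz i⟩ ∈ F → ⟨z i, hz i⟩ ∉ A := fun _ h =>
    Set.disjoint_left.1 hFA h
  have hFB' : ∀ i, ⟨z i, hz i⟩ ∈ F → ⟨z i, hz i⟩ ∉ B := fun _ h =>
    Set.disjoint_left.1 hFB h
  have hAB' : ∀ i, ⟨z i, hz i⟩ ∈ A → ⟨z i, hz i⟩ ∉ B := fun _ h =>
    Set.disjoint_left.1 hAB h
  have hcov' := fun i => hcov ⟨z i, hz i⟩
  have hdisj : ∀ S T : Set ((Set.range u ∪ Set.range v)ᶜ : Set V), Disjoint S T →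
      ∀ p q : ZMod k → Prop, (∀ i, p i → ¬q i) →
        Disjoint (Subtype.val '' S ∪ u '' {i | p i}) (Subtype.val '' T ∪ u '' {i | q i}) := by
    intro S T hST p q hpq
    rw [Set.disjoint_left]
    rintro _ (⟨x, hx, rfl⟩ | ⟨i, hi, rfl⟩) (⟨y, hy, h⟩ | ⟨m, hm, h⟩)
    · exact Set.disjoint_left.1 hST hx (Subtype.ext h ▸ hy)
    · exact x.2 (Or.inl ⟨m, h⟩)
    · exact y.2 (Or.inl ⟨i, h.symm⟩)
    · exact hpq i hi (hu h ▸ hm)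
  have hdisjv : ∀ (T : Set ((Set.range u ∪ Set.range v)ᶜ : Set V)) (q : ZMod k → Prop),
      Disjoint (Set.range v) (Subtype.val '' T ∪ u '' {i | q i}) := by
    intro T q
    rw [Set.disjoint_left]
    rintro _ ⟨i, rfl⟩ (⟨y, hy, h⟩ | ⟨m, hm, h⟩)
    · exact y.2 (Or.inr ⟨i, h.symm⟩)
    · exact huv m i h
  refine hG ⟨_, Subtype.val '' A ∪ u '' {i | z i ∈ Subtype.val '' F ∧ d i},
    Subtype.val '' B ∪ u '' {i | z i ∈ Subtype.val '' F ∧ ¬d i}, ?_, ?_, ?_, ?_,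
    isAcyclic_induce_union_cycle huv hu hnu hnv hz hac ((hval F l).2 hl),
    TwoIndepSet.union_image huv hu hnu hnv hz hA ?_,
    TwoIndepSet.union_image huv hu hnu hnv hz hB ?_⟩
  · intro x
    by_cases hx : x ∈ Set.range u ∪ Set.range v
    · rcases hx with ⟨i, rfl⟩ | hx
      · by_cases h1 : z i ∈ Subtype.val '' F
        · by_cases h2 : d i
          · exact Or.inr (Or.inl (Or.inr ⟨i, ⟨h1, h2⟩, rfl⟩))
          · exact Or.inr (Or.inr (Or.inr ⟨i, ⟨h1, h2⟩, rfl⟩))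
        · exact Or.inl (Or.inr ⟨i, h1, rfl⟩)
      · exact Or.inl (Or.inl (Or.inr hx))
    · rcases hcov ⟨x, hx⟩ with h | h | h
      · exact Or.inl (Or.inl (Or.inl ⟨_, h, rfl⟩))
      · exact Or.inr (Or.inl (Or.inl ⟨_, h, rfl⟩))
      · exact Or.inr (Or.inr (Or.inl ⟨_, h, rfl⟩))
  · rw [Set.union_right_comm, Set.disjoint_union_left]
    exact ⟨hdisj F A hFA _ _ fun i hi hi' => hi hi'.1, hdisjv A _⟩
  · rw [Set.union_right_comm, Set.disjoint_union_left]
    exact ⟨hdisj F B hFB _ _ fun i hi hi' => hi hi'.1, hdisjv B _⟩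
  · exact hdisj A B hAB _ _ fun i hi hi' => hi'.2 hi.2
  · simp only [hval]
    grind
  · simp only [hval]
    grind
end
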